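/- arXiv:1801.08428 — 3 statements merged into one kernel-verified Lean document; each statement's English description precedes it below -/
import Mathlib

section
/- If det[s₁*·r₁, r₁₂, r₂ + p·s₁*·r, p₁·r₁₁₂ + s₁*·r₁₁] = 0 for some single value s₁* ≠ 0, then det[s₁·r₁, r₁₂, r₂ + p·s₁·r, p₁·r₁₁₂ + s₁·r₁₁] = 0 for every s₁ ∈ ℝ. (Geometrically: if the tangent planes of two neighbouring quadrics of a discrete asymptotic net coincide at one point of their common edge other than the vertices, then they coincide at every point of the common edge.) -/
/-- Determinant of the 4×4 matrix whose columns are `v₁, v₂, v₃, v₄`. -/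
noncomputable def det4 (v₁ v₂ v₃ v₄ : Fin 4 → ℝ) : ℝ :=
  Matrix.det (Matrix.of fun i j => ![v₁, v₂, v₃, v₄] j i)

theorem det4_ne_zero_of_linearIndependent {v₁ v₂ v₃ v₄ : Fin 4 → ℝ}
    (hv : LinearIndependent ℝ ![v₁, v₂, v₃, v₄]) : det4 v₁ v₂ v₃ v₄ ≠ 0 := by
  have hu : IsUnit (Matrix.of ![v₁, v₂, v₃, v₄]) :=
    Matrix.linearIndependent_rows_iff_isUnit.mp hv
  have hdet := ((Matrix.isUnit_iff_isUnit_det _).mp hu).ne_zero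
  rwa [← Matrix.det_transpose] at hdet

theorem det4_tangent_planes (r r₁ r₂ r₁₂ : Fin 4 → ℝ) (α0 α1 α3 β1 β2 β3 p p₁ s : ℝ) :
    det4 (s • r₁) r₁₂ (r₂ + (p * s) • r)
        (p₁ • (β1 • r₁ + β2 • r₂ + β3 • r₁₂) + s • (α0 • r + α1 • r₁ + α3 • r₁₂)) =
      s ^ 2 * ((α0 - p * p₁ * β2) * det4 r r₁ r₂ r₁₂) := by
  simp [det4, Matrix.det_succ_row_zero, Fin.sum_univ_succ, Fin.succAbove]
  ring

/-- if the tangent planes of two neighbouring quadrics of a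
discrete asymptotic net coincide at one point of their common edge other than
the vertices (i.e. the C¹-determinant condition holds for one `s₁* ≠ 0`), then
they coincide at every point of the common edge (the determinant condition
holds for every `s₁`). -/
theorem stmt1 (r r₁ r₂ r₁₂ : Fin 4 → ℝ)
    (hbasis : LinearIndependent ℝ ![r, r₁, r₂, r₁₂])
    (α0 α1 α3 β1 β2 β3 : ℝ)
    (hα0 : α0 ≠ 0) (hα3 : α3 ≠ 0) (hβ1 : β1 ≠ 0) (hβ2 : β2 ≠ 0)
    (r₁₁ r₁₁₂ : Fin 4 → ℝ)
    (hr₁₁ : r₁₁ = α0 • r + α1 • r₁ + α3 • r₁₂)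
    (hr₁₁₂ : r₁₁₂ = β1 • r₁ + β2 • r₂ + β3 • r₁₂)
    (p p₁ : ℝ) (hp : p ≠ 0) (hp₁ : p₁ ≠ 0)
    (s₁star : ℝ) (hs₁star : s₁star ≠ 0)
    (h : det4 (s₁star • r₁) r₁₂ (r₂ + (p * s₁star) • r)
          (p₁ • r₁₁₂ + s₁star • r₁₁) = 0) :
    ∀ s₁ : ℝ, det4 (s₁ • r₁) r₁₂ (r₂ + (p * s₁) • r)
          (p₁ • r₁₁₂ + s₁ • r₁₁) = 0 := by
  subst hr₁₁ hr₁₁₂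
  rw [det4_tangent_planes] at h
  have hcoeff : α0 - p * p₁ * β2 = 0 :=
    (mul_eq_zero.mp ((mul_eq_zero.mp h).resolve_left (pow_ne_zero 2 hs₁star))).resolve_right
      (det4_ne_zero_of_linearIndependent hbasis)
  intro s₁
  rw [det4_tangent_planes, hcoeff, zero_mul, mul_zero]
end

section
/- Assume the C¹ condition p₁·β²·p = α⁰. Let s, t ∈ ℝ with s ≠ 0, t ≠ 0 and 2α³β²s − α¹β²p + α⁰β³ ≠ 0; set s₁ := 𝒮¹(s) = (α¹β²ps + 2α⁰β¹p − α⁰β³s)/(p(2α³β²s − α¹β²p + α⁰β³)), t₁ := 𝒯¹(t) = (2α⁰β²p − α¹β²pt − α⁰β³t)/(2β²pt), X := Q(s,t) and X₁ := Q₁(s₁,t₁). Then det[r, r₁, X, X₁] = 0 if and only if D¹ = 0, where D¹ := (α⁰β³ − α¹β²p)² + 4α⁰α³β¹β²p; that is, the line joining X to r and the line joining X₁ to r₁ (neighbouring lines of the line congruence ℒ) intersect precisely when D¹ = 0. Moreover, det[r₂, r₁₂, X, X₁] = 0 if and only if D¹ = 0 (so the line congruence ℒ² has the intersection property in the first lattice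 direction precisely when ℒ does). -/
theorem det4_ne_zero {v₁ v₂ v₃ v₄ : Fin 4 → ℝ} (h : LinearIndependent ℝ ![v₁, v₂, v₃, v₄]) :
    det4 v₁ v₂ v₃ v₄ ≠ 0 := by
  have hu := (Matrix.linearIndependent_rows_iff_isUnit (A := Matrix.of ![v₁, v₂, v₃, v₄])).1 h
  rw [Matrix.isUnit_iff_isUnit_det, ← Matrix.det_transpose] at hu
  exact hu.ne_zero

theorem det4_comb_left (v₁ v₂ v₃ v₄ : Fin 4 → ℝ) (a b c d a' b' c' d' : ℝ) :
    det4 v₁ v₂ (a • v₁ + b • v₂ + c • v₃ + d • v₄) (a' • v₁ + b' • v₂ + c' • v₃ + d' • v₄) =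
      (c * d' - d * c') * det4 v₁ v₂ v₃ v₄ := by
  simp [det4, Matrix.det_succ_row_zero, Fin.sum_univ_succ, Fin.succAbove]
  ring

theorem det4_comb_right (v₁ v₂ v₃ v₄ : Fin 4 → ℝ) (a b c d a' b' c' d' : ℝ) :
    det4 v₃ v₄ (a • v₁ + b • v₂ + c • v₃ + d • v₄) (a' • v₁ + b' • v₂ + c' • v₃ + d' • v₄) =
      (a * b' - b * a') * det4 v₁ v₂ v₃ v₄ := by
  simp [det4, Matrix.det_succ_row_zero, Fin.sum_univ_succ, Fin.succAbove]
  ring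

/-- the lines `[X, r]` and `[X₁, r₁]` of the line congruence `ℒ`
intersect (i.e. `det[r, r₁, X, X₁] = 0`) precisely when `D¹ = 0`, and likewise
the lines `[X, r₂]` and `[X₁, r₁₂]` of `ℒ²` intersect (`det[r₂, r₁₂, X, X₁] = 0`)
precisely when `D¹ = 0`. -/
theorem stmt9 (r r₁ r₂ r₁₂ : Fin 4 → ℝ)
    (hbasis : LinearIndependent ℝ ![r, r₁, r₂, r₁₂])
    (α0 α1 α3 β1 β2 β3 : ℝ)
    (hα0 : α0 ≠ 0) (hα3 : α3 ≠ 0) (hβ1 : β1 ≠ 0) (hβ2 : β2 ≠ 0)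
    (r₁₁ r₁₁₂ : Fin 4 → ℝ)
    (hr₁₁ : r₁₁ = α0 • r + α1 • r₁ + α3 • r₁₂)
    (hr₁₁₂ : r₁₁₂ = β1 • r₁ + β2 • r₂ + β3 • r₁₂)
    (p p₁ : ℝ) (hp : p ≠ 0) (hp₁ : p₁ ≠ 0)
    (Q Q₁ : ℝ → ℝ → (Fin 4 → ℝ))
    (hQ : ∀ s t, Q s t = p • r₁₂ + s • r₁ + t • r₂ + (s * t) • r)
    (hQ₁ : ∀ s₁ t₁, Q₁ s₁ t₁ = p₁ • r₁₁₂ + s₁ • r₁₁ + t₁ • r₁₂ + (s₁ * t₁) • r₁)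
    (hC1 : p₁ * β2 * p = α0)
    (s t : ℝ) (hs : s ≠ 0) (ht : t ≠ 0)
    (hden : 2 * α3 * β2 * s - α1 * β2 * p + α0 * β3 ≠ 0)
    (s₁ t₁ : ℝ)
    (hs₁ : s₁ = (α1 * β2 * p * s + 2 * α0 * β1 * p - α0 * β3 * s) /
      (p * (2 * α3 * β2 * s - α1 * β2 * p + α0 * β3)))
    (ht₁ : t₁ = (2 * α0 * β2 * p - α1 * β2 * p * t - α0 * β3 * t) /
      (2 * β2 * p * t))
    (D1 : ℝ)
    (hD1 : D1 = (α0 * β3 - α1 * β2 * p) ^ 2 + 4 * α0 * α3 * β1 * β2 * p) :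
    (det4 r r₁ (Q s t) (Q₁ s₁ t₁) = 0 ↔ D1 = 0) ∧
    (det4 r₂ r₁₂ (Q s t) (Q₁ s₁ t₁) = 0 ↔ D1 = 0) := by
  have hdet := det4_ne_zero hbasis
  have hX : Q s t = (s * t) • r + s • r₁ + t • r₂ + p • r₁₂ := by
    rw [hQ]; module
  have hX₁ : Q₁ s₁ t₁ = (s₁ * α0) • r + (p₁ * β1 + s₁ * α1 + s₁ * t₁) • r₁ +
      (p₁ * β2) • r₂ + (p₁ * β3 + s₁ * α3 + t₁) • r₁₂ := by
    rw [hQ₁, hr₁₁, hr₁₁₂]; module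
  have hp₁_eq : p₁ = α0 / (β2 * p) := by
    rw [eq_div_iff (mul_ne_zero hβ2 hp), ← mul_assoc, hC1]
  set δ := 2 * α3 * β2 * s - α1 * β2 * p + α0 * β3 with hδ
  have hs₁_mul : s₁ * (p * δ) = α1 * β2 * p * s + 2 * α0 * β1 * p - α0 * β3 * s := by
    rw [hs₁, div_mul_cancel₀ _ (mul_ne_zero hp hden)]
  have hleft : t * (p₁ * β3 + s₁ * α3 + t₁) - p * (p₁ * β2) = t / (2 * β2 * p * δ) * D1 := by
    rw [hp₁_eq, ht₁, hD1]
    field_simp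
    linear_combination (2 * α3 * β2 * t) * hs₁_mul +
      (t * (α0 * β3 - α1 * β2 * p)) * hδ
  have hright : s * t * (p₁ * β1 + s₁ * α1 + s₁ * t₁) - s * (s₁ * α0) =
      s ^ 2 * t / (2 * β2 * p ^ 2 * δ) * D1 := by
    rw [hp₁_eq, ht₁, hD1]
    field_simp
    linear_combination (-(t * (α0 * β3 - α1 * β2 * p))) * hs₁_mul +
      (2 * t * α0 * β1 * p) * hδ
  rw [hX, hX₁, det4_comb_left, det4_comb_right, hleft, hright]
  simp [hdet, hs, ht, hp, hβ2, hden]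
end

section
/- Let f, g : ℝ → ℝ be smooth functions with f' > 0 and g' > 0 everywhere, and let r : ℝ² → ℝ⁴ and p, q, V, W : ℝ² → ℝ be smooth functions such that r satisfies the projective Gauss–Weingarten equations r_xx = p·r_y + (1/2)(V − p_y)·r and r_yy = q·r_x + (1/2)(W − q_x)·r. Define r̂(x,y) := (f'(x)·g'(y))^(−1/2) · r(f(x), g(y)). Then r̂ satisfies r̂_xx = p̂·r̂_y + (1/2)(V̂ − p̂_y)·r̂ and r̂_yy = q̂·r̂_x + (1/2)(Ŵ − q̂_x)·r̂, where p̂(x,y) = p(f(x),g(y))·f'(x)²/g'(y), q̂(x,y) = q(f(x),g(y))·g'(y)²/f'(x), V̂(x,y) = V(f(x),g(y))·f'(x)² − S(f)(x), Ŵ(x,y) = W(f(x),g(y))·g'(y)² − S(g)(y), and S(h) := h'''/h' − (3/2)·(h''/h')² denotes the Schwarzian derivative. In particular p̂(x,y)·q̂(x,y) = p(f(x),g(y))·q(f(x),g(y))·f'(x)·g'(y), so the projective metric pq·dx dy is invariant. (This realises the transformation group under which the Wilczynski lift is unique, with the coefficient transformation laws involving the Schwarzian derivative.) -/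
/-- Partial derivative with respect to the first variable. -/
noncomputable def pd1 {E : Type*} [NormedAddCommGroup E] [NormedSpace ℝ E]
    (f : ℝ → ℝ → E) : ℝ → ℝ → E := fun x y => deriv (fun x' => f x' y) x

/-- Partial derivative with respect to the second variable. -/
noncomputable def pd2 {E : Type*} [NormedAddCommGroup E] [NormedSpace ℝ E]
    (f : ℝ → ℝ → E) : ℝ → ℝ → E := fun x y => deriv (fun y' => f x y') y

/-- Schwarzian derivative `S(h) = h'''/h' − (3/2)(h''/h')²`. -/
noncomputable def schwarzian (h : ℝ → ℝ) : ℝ → ℝ := fun x =>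
  deriv (deriv (deriv h)) x / deriv h x - (3 / 2) * (deriv (deriv h) x / deriv h x) ^ 2

theorem HasDerivAt.inv_sqrt {h : ℝ → ℝ} {h' x : ℝ} (hh : HasDerivAt h h' x) (hx : 0 < h x) :
    HasDerivAt (fun t => (Real.sqrt (h t))⁻¹)
      (-(1 / 2) * (h' / h x) * (Real.sqrt (h x))⁻¹) x := by
  have hs : 0 < Real.sqrt (h x) := Real.sqrt_pos.2 hx
  refine ((hh.sqrt hx.ne').fun_inv hs.ne').congr_deriv ?_
  have h2 : h x = Real.sqrt (h x) ^ 2 := (Real.sq_sqrt hx.le).symm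
  generalize Real.sqrt (h x) = s at *
  rw [h2]
  field_simp

/-- The inverse square root of `h'` solves `u'' = -S(h) u / 2`. -/
theorem hasDerivAt_deriv_inv_sqrt_deriv {h : ℝ → ℝ} {x : ℝ}
    (h1 : HasDerivAt (deriv h) (deriv (deriv h) x) x)
    (h2 : HasDerivAt (deriv (deriv h)) (deriv (deriv (deriv h)) x) x) (hx : 0 < deriv h x) :
    HasDerivAt (fun t => -(1 / 2) * (deriv (deriv h) t / deriv h t) * (Real.sqrt (deriv h t))⁻¹)
      (-(1 / 2) * schwarzian h x * (Real.sqrt (deriv h x))⁻¹) x := by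
  refine (((h2.fun_div h1 hx.ne').const_mul (-(1 / 2))).fun_mul (h1.inv_sqrt hx)).congr_deriv ?_
  unfold schwarzian
  field_simp
  ring

theorem ContDiff.hasDerivAt_pd1 {E : Type*} [NormedAddCommGroup E] [NormedSpace ℝ E]
    {r : ℝ → ℝ → E} (hr : ContDiff ℝ (⊤ : ℕ∞) (fun z : ℝ × ℝ => r z.1 z.2)) (x y : ℝ) :
    HasDerivAt (fun t => r t y) (pd1 r x y) x := by
  have h : ContDiff ℝ (⊤ : ℕ∞) (fun t => r t y) :=
    hr.comp (contDiff_id.prodMk contDiff_const)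
  exact (h.differentiable (by simp) x).hasDerivAt

theorem ContDiff.hasDerivAt_pd2 {E : Type*} [NormedAddCommGroup E] [NormedSpace ℝ E]
    {r : ℝ → ℝ → E} (hr : ContDiff ℝ (⊤ : ℕ∞) (fun z : ℝ × ℝ => r z.1 z.2)) (x y : ℝ) :
    HasDerivAt (fun t => r x t) (pd2 r x y) y := by
  have h : ContDiff ℝ (⊤ : ℕ∞) (fun t => r x t) :=
    hr.comp (contDiff_const.prodMk contDiff_id)
  exact (h.differentiable (by simp) y).hasDerivAt

theorem ContDiff.hasDerivAt_pd1_pd1 {E : Type*} [NormedAddCommGroup E] [NormedSpace ℝ E]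
    {r : ℝ → ℝ → E} (hr : ContDiff ℝ (⊤ : ℕ∞) (fun z : ℝ × ℝ => r z.1 z.2)) (x y : ℝ) :
    HasDerivAt (fun t => pd1 r t y) (pd1 (pd1 r) x y) x := by
  have h : ContDiff ℝ (⊤ : ℕ∞) (fun t => r t y) :=
    hr.comp (contDiff_id.prodMk contDiff_const)
  have h' : ContDiff ℝ (⊤ : ℕ∞) (deriv (fun t => r t y)) := (contDiff_infty_iff_deriv.1 h).2
  exact (h'.differentiable (by simp) x).hasDerivAt

/-- Transformation law of one of the two projective Gauss–Weingarten equations. -/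
theorem gaussWeingarten_reparam {E : Type*} [NormedAddCommGroup E] [NormedSpace ℝ E]
    {f g : ℝ → ℝ} {r : ℝ → ℝ → E} {p V : ℝ → ℝ → ℝ}
    (hf : ContDiff ℝ (⊤ : ℕ∞) f) (hg : ContDiff ℝ (⊤ : ℕ∞) g)
    (hf' : ∀ x, 0 < deriv f x) (hg' : ∀ y, 0 < deriv g y)
    (hr : ContDiff ℝ (⊤ : ℕ∞) (fun z : ℝ × ℝ => r z.1 z.2))
    (hp : ContDiff ℝ (⊤ : ℕ∞) (fun z : ℝ × ℝ => p z.1 z.2))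
    (hGW : ∀ x y, pd1 (pd1 r) x y =
      p x y • pd2 r x y + ((1 / 2) * (V x y - pd2 p x y)) • r x y)
    {rhat : ℝ → ℝ → E} {phat Vhat : ℝ → ℝ → ℝ}
    (hrhat : ∀ x y, rhat x y =
      (Real.sqrt (deriv f x * deriv g y))⁻¹ • r (f x) (g y))
    (hphat : ∀ x y, phat x y = p (f x) (g y) * (deriv f x) ^ 2 / deriv g y)
    (hVhat : ∀ x y, Vhat x y = V (f x) (g y) * (deriv f x) ^ 2 - schwarzian f x) (x y : ℝ) :
    pd1 (pd1 rhat) x y =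
      phat x y • pd2 rhat x y + ((1 / 2) * (Vhat x y - pd2 phat x y)) • rhat x y := by
  have hasDeriv {h : ℝ → ℝ} (hh : ContDiff ℝ (⊤ : ℕ∞) h) (t : ℝ) :
      HasDerivAt h (deriv h t) t := (hh.differentiable (by simp) t).hasDerivAt
  have hf1 := (contDiff_infty_iff_deriv.1 hf).2
  have hf2 := (contDiff_infty_iff_deriv.1 hf1).2
  have hg1 := (contDiff_infty_iff_deriv.1 hg).2
  obtain rfl : rhat = fun x y =>
      (Real.sqrt (deriv g y))⁻¹ • (Real.sqrt (deriv f x))⁻¹ • r (f x) (g y) := by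
    funext x y
    rw [hrhat, Real.sqrt_mul (hf' x).le, mul_inv, smul_smul, mul_comm]
  obtain rfl : phat = fun x y => p (f x) (g y) * (deriv f x) ^ 2 / deriv g y := by
    funext x y
    exact hphat x y
  have hrx (t : ℝ) : HasDerivAt (fun t => r (f t) (g y)) (deriv f t • pd1 r (f t) (g y)) t :=
    (hr.hasDerivAt_pd1 (f t) (g y)).scomp t (hasDeriv hf t)
  have hrxx : HasDerivAt (fun t => pd1 r (f t) (g y))
      (deriv f x • pd1 (pd1 r) (f x) (g y)) x :=
    (hr.hasDerivAt_pd1_pd1 (f x) (g y)).scomp x (hasDeriv hf x)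
  have hry : HasDerivAt (fun t => r (f x) (g t)) (deriv g y • pd2 r (f x) (g y)) y :=
    (hr.hasDerivAt_pd2 (f x) (g y)).scomp y (hasDeriv hg y)
  have hpy : HasDerivAt (fun t => p (f x) (g t)) (deriv g y • pd2 p (f x) (g y)) y :=
    (hp.hasDerivAt_pd2 (f x) (g y)).scomp y (hasDeriv hg y)
  have hu (t : ℝ) := (hasDeriv hf1 t).inv_sqrt (hf' t)
  have hv := (hasDeriv hg1 y).inv_sqrt (hg' y)
  have huu := hasDerivAt_deriv_inv_sqrt_deriv (hasDeriv hf1 x) (hasDeriv hf2 x) (hf' x)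
  have e1 (t : ℝ) := (((hu t).fun_smul (hrx t)).fun_const_smul (Real.sqrt (deriv g y))⁻¹).deriv
  have e2 := ((((hu x).fun_smul ((hasDeriv hf1 x).fun_smul hrxx)).fun_add
    (huu.fun_smul (hrx x))).fun_const_smul (Real.sqrt (deriv g y))⁻¹).deriv
  have e3 := (hv.fun_smul (hry.fun_const_smul (Real.sqrt (deriv f x))⁻¹)).deriv
  have e4 := ((hpy.mul_const (deriv f x ^ 2)).fun_div (hasDeriv hg1 y) (hg' y).ne').deriv
  conv_lhs => simp only [pd1]
  simp only [pd1] at e1 e2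
  simp only [e1, e2]
  have e5 := hGW (f x) (g y)
  simp only [pd1] at e5
  rw [e5]
  conv_rhs => simp only [pd2]
  simp only [pd2] at e3 e4 ⊢
  rw [e3, e4, hVhat]
  have := (hf' x).ne'
  have := (hg' y).ne'
  match_scalars <;> field_simp <;> ring

/-- the reparametrised and rescaled Wilczynski lift
`r̂(x,y) = (f'(x)g'(y))^(−1/2)·r(f(x),g(y))` again satisfies the projective
Gauss–Weingarten equations, with coefficients transformed via the Schwarzian
derivative; in particular the projective metric `pq·dxdy` is invariant. -/
theorem stmt17 (f g : ℝ → ℝ) (r : ℝ → ℝ → (Fin 4 → ℝ)) (p q V W : ℝ → ℝ → ℝ)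
    (hf : ContDiff ℝ (⊤ : ℕ∞) f) (hg : ContDiff ℝ (⊤ : ℕ∞) g)
    (hf' : ∀ x, 0 < deriv f x) (hg' : ∀ y, 0 < deriv g y)
    (hr : ContDiff ℝ (⊤ : ℕ∞) (fun z : ℝ × ℝ => r z.1 z.2))
    (hp : ContDiff ℝ (⊤ : ℕ∞) (fun z : ℝ × ℝ => p z.1 z.2))
    (hq : ContDiff ℝ (⊤ : ℕ∞) (fun z : ℝ × ℝ => q z.1 z.2))
    (hV : ContDiff ℝ (⊤ : ℕ∞) (fun z : ℝ × ℝ => V z.1 z.2))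
    (hW : ContDiff ℝ (⊤ : ℕ∞) (fun z : ℝ × ℝ => W z.1 z.2))
    (hGW1 : ∀ x y, pd1 (pd1 r) x y =
      p x y • pd2 r x y + ((1 / 2) * (V x y - pd2 p x y)) • r x y)
    (hGW2 : ∀ x y, pd2 (pd2 r) x y =
      q x y • pd1 r x y + ((1 / 2) * (W x y - pd1 q x y)) • r x y)
    (rhat : ℝ → ℝ → (Fin 4 → ℝ)) (phat qhat Vhat What : ℝ → ℝ → ℝ)
    (hrhat : ∀ x y, rhat x y =
      (Real.sqrt (deriv f x * deriv g y))⁻¹ • r (f x) (g y))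
    (hphat : ∀ x y, phat x y = p (f x) (g y) * (deriv f x) ^ 2 / deriv g y)
    (hqhat : ∀ x y, qhat x y = q (f x) (g y) * (deriv g y) ^ 2 / deriv f x)
    (hVhat : ∀ x y, Vhat x y = V (f x) (g y) * (deriv f x) ^ 2 - schwarzian f x)
    (hWhat : ∀ x y, What x y = W (f x) (g y) * (deriv g y) ^ 2 - schwarzian g y) :
    (∀ x y, pd1 (pd1 rhat) x y =
      phat x y • pd2 rhat x y + ((1 / 2) * (Vhat x y - pd2 phat x y)) • rhat x y) ∧
    (∀ x y, pd2 (pd2 rhat) x y =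
      qhat x y • pd1 rhat x y + ((1 / 2) * (What x y - pd1 qhat x y)) • rhat x y) ∧
    (∀ x y, phat x y * qhat x y =
      p (f x) (g y) * q (f x) (g y) * deriv f x * deriv g y) := by
  refine ⟨gaussWeingarten_reparam hf hg hf' hg' hr hp hGW1 hrhat hphat hVhat,
    fun x y => ?_, fun x y => ?_⟩
  · have swap : ContDiff ℝ (⊤ : ℕ∞) (Prod.swap : ℝ × ℝ → ℝ × ℝ) :=
      contDiff_snd.prodMk contDiff_fst
    exact gaussWeingarten_reparam (r := fun a b => r b a) (p := fun a b => q b a)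
      (V := fun a b => W b a) (rhat := fun a b => rhat b a) (phat := fun a b => qhat b a)
      (Vhat := fun a b => What b a) hg hf hg' hf' (hr.comp swap) (hq.comp swap)
      (fun a b => hGW2 b a) (fun a b => by rw [hrhat, mul_comm]) (fun a b => hqhat b a)
      (fun a b => hWhat b a) y x
  · have := (hf' x).ne'
    have := (hg' y).ne'
    rw [hphat, hqhat]
    field_simp
end
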